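/- Let d ≥ 1, let P(C_1), P(C_2) > 0 be priors, W : Fin d → ℝ weights, and for two examples X and X' let p_i^k > 0 and q_i^k > 0 denote P(X_i | C_k) and P(X'_i | C_k) (k = 1, 2). Define the posteriors P(C_1 | X) and P(C_1 | X') by the weighted naive Bayes formula and define Δ(X, X') = Σ_{i=1}^d W_i (log p_i^2 − log p_i^1) − Σ_{i=1}^d W_i (log q_i^2 − log q_i^1) (the criterion with target class C_1). Then P(C_1 | X') > P(C_1 | X) if and only if Δ(X, X') > 0, and P(C_1 | X') = P(C_1 | X) if and only if Δ(X, X') = 0. -/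

import Mathlib

open Real BigOperators

lemma prod_rpow_eq_exp_sum_mul_log {ι : Type*} [Fintype ι] (w p : ι → ℝ) (hp : ∀ i, 0 < p i) :
    ∏ i, p i ^ w i = Real.exp (∑ i, w i * Real.log (p i)) := by
  rw [Real.exp_sum]
  refine Finset.prod_congr rfl fun i _ => ?_
  rw [Real.rpow_def_of_pos (hp i), mul_comm]

/-- Two-class posteriors with log-likelihoods `a, b` and `c, e` are ordered as the log-odds. -/
lemma posterior_exp_lt_iff {P Q : ℝ} (hP : 0 < P) (hQ : 0 < Q) (a b c e : ℝ) :
    P * Real.exp a / (P * Real.exp a + Q * Real.exp b) <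
      P * Real.exp c / (P * Real.exp c + Q * Real.exp e) ↔ a - b < c - e := by
  rw [div_lt_div_iff₀ (by positivity) (by positivity)]
  have key : P * Real.exp c * (P * Real.exp a + Q * Real.exp b) -
      P * Real.exp a * (P * Real.exp c + Q * Real.exp e) =
      P * Q * (Real.exp (c + b) - Real.exp (a + e)) := by
    rw [Real.exp_add, Real.exp_add]
    ring
  rw [← sub_pos, key, mul_pos_iff_of_pos_left (by positivity), sub_pos, Real.exp_lt_exp]
  constructor <;> intro h <;> linarith

/-- For a two-class weighted naive Bayes model, the posterior of target class
`C₁` strictly increases from `X` to `X'` iff the counterfactual criterion `Δ`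
is positive, and is unchanged iff `Δ = 0`. -/
theorem naiveBayes_posterior_increase_iff_delta_pos
    (d : ℕ) (hd : 1 ≤ d)
    (P1 P2 : ℝ) (hP1 : 0 < P1) (hP2 : 0 < P2)
    (W : Fin d → ℝ)
    (p1 p2 q1 q2 : Fin d → ℝ)
    (hp1 : ∀ i, 0 < p1 i) (hp2 : ∀ i, 0 < p2 i)
    (hq1 : ∀ i, 0 < q1 i) (hq2 : ∀ i, 0 < q2 i)
    (postX postX' Δ : ℝ)
    (hpostX : postX = (P1 * ∏ i, (p1 i) ^ (W i)) /
        (P1 * ∏ i, (p1 i) ^ (W i) + P2 * ∏ i, (p2 i) ^ (W i)))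
    (hpostX' : postX' = (P1 * ∏ i, (q1 i) ^ (W i)) /
        (P1 * ∏ i, (q1 i) ^ (W i) + P2 * ∏ i, (q2 i) ^ (W i)))
    (hΔ : Δ = (∑ i, W i * (Real.log (p2 i) - Real.log (p1 i)))
            - (∑ i, W i * (Real.log (q2 i) - Real.log (q1 i)))) :
    (postX' > postX ↔ Δ > 0) ∧ (postX' = postX ↔ Δ = 0) := by
  simp only [mul_sub, Finset.sum_sub_distrib] at hΔ
  rw [prod_rpow_eq_exp_sum_mul_log W _ hp1, prod_rpow_eq_exp_sum_mul_log W _ hp2] at hpostX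
  rw [prod_rpow_eq_exp_sum_mul_log W _ hq1, prod_rpow_eq_exp_sum_mul_log W _ hq2] at hpostX'
  have increase : postX < postX' ↔ 0 < Δ := by
    rw [hpostX, hpostX', posterior_exp_lt_iff hP1 hP2, hΔ]
    constructor <;> intro h <;> linarith
  have decrease : postX' < postX ↔ Δ < 0 := by
    rw [hpostX, hpostX', posterior_exp_lt_iff hP1 hP2, hΔ]
    constructor <;> intro h <;> linarith
  refine ⟨increase, ?_⟩
  rw [eq_iff_le_not_lt, eq_iff_le_not_lt, ← not_lt, ← not_lt, increase, decrease]
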